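/- arXiv:1610.02932 — 5 statements merged into one kernel-verified Lean document; each statement's English description precedes it below -/
import Mathlib

section
/- Let (X, d) be a metric space and m a Borel measure on X. Let r > 0, s ∈ (0, r), C ≥ 1 and ε > 0 with C·ε ≤ 1. Let γ : [0, r] → X satisfy d(γ(t), γ(t')) ≤ |t − t'| for all t, t' ∈ [0, r] (e.g. γ a unit-speed minimal geodesic), and assume for every t ∈ [0, r] that 0 < m(B_{s/2}(γ(t))), that m(B_{2s}(γ(t))) < ∞, and the doubling-type bound m(B_{2s}(γ(t))) ≤ C · m(B_{s/2}(γ(t))). Let g : X → ℝ be integrable on B_{2s}(γ(t)) for every t ∈ [0, r], and let c : [0, r] → {−1, 1} satisfy ∫_{B_s(γ(t))} |g − c(t)| dm < ε · m(B_s(γ(t))) for every t ∈ [0, r]. Then c(r) = c(0). -/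
open MeasureTheory Metric

/-- If `g` is on average close to `a` on `S` and close to `b` on `T`, and `S ∩ T` contains a set `B`
whose measure controls those of `S` and `T`, then `|a - b| < 2`. -/
theorem abs_sub_lt_two_of_setIntegral_abs_sub_lt {X : Type*} [MeasurableSpace X] {m : Measure X}
    {B S T D : Set X} {g : X → ℝ} {a b C ε : ℝ}
    (hBS : B ⊆ S) (hBT : B ⊆ T) (hSD : S ⊆ D) (hTD : T ⊆ D)
    (hB : 0 < m B) (hD : m D < ⊤) (hDB : m D ≤ ENNReal.ofReal C * m B)
    (hC : 0 ≤ C) (hε : 0 ≤ ε) (hCε : C * ε ≤ 1) (hg : IntegrableOn g D m)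
    (ha : ∫ x in S, |g x - a| ∂m < ε * m.real S)
    (hb : ∫ x in T, |g x - b| ∂m < ε * m.real T) : |a - b| < 2 := by
  have hBD := hBS.trans hSD
  have hBtop : m B ≠ ⊤ := ((measure_mono hBD).trans_lt hD).ne
  have hint (e : ℝ) : IntegrableOn (fun x => |g x - e|) D m :=
    (hg.sub (integrableOn_const hD.ne)).abs
  have hmono {U : Set X} (hBU : B ⊆ U) (hUD : U ⊆ D) (e : ℝ) :
      ∫ x in B, |g x - e| ∂m ≤ ∫ x in U, |g x - e| ∂m :=
    setIntegral_mono_set ((hint e).mono_set hUD)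
      (Filter.Eventually.of_forall fun _ => abs_nonneg _) hBU.eventuallyLE
  have htri : |a - b| * m.real B ≤ ∫ x in B, |g x - a| ∂m + ∫ x in B, |g x - b| ∂m := by
    rw [← integral_add ((hint a).mono_set hBD) ((hint b).mono_set hBD)]
    calc |a - b| * m.real B = ∫ _ in B, |a - b| ∂m := by
          rw [setIntegral_const, smul_eq_mul, mul_comm]
      _ ≤ _ := by
          refine integral_mono (integrableOn_const hBtop)
            (((hint a).mono_set hBD).add ((hint b).mono_set hBD)) fun x => ?_
          simpa [abs_sub_comm a (g x)] using abs_sub_le a (g x) b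
  have hS : m.real S ≤ m.real D := measureReal_mono hSD hD.ne
  have hT : m.real T ≤ m.real D := measureReal_mono hTD hD.ne
  have hDB' : m.real D ≤ C * m.real B := by
    have h := ENNReal.toReal_mono (ENNReal.mul_ne_top ENNReal.ofReal_ne_top hBtop) hDB
    rwa [ENNReal.toReal_mul, ENNReal.toReal_ofReal hC] at h
  have hB' : 0 < m.real B := ENNReal.toReal_pos hB.ne' hBtop
  refine lt_of_mul_lt_mul_right ?_ hB'.le
  calc |a - b| * m.real B < ε * m.real S + ε * m.real T := by
        linarith [hmono hBS hSD a, hmono hBT hTD b]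
    _ ≤ ε * (C * m.real B) + ε * (C * m.real B) := by
        gcongr
        exacts [hS.trans hDB', hT.trans hDB']
    _ = 2 * (C * ε * m.real B) := by ring
    _ ≤ 2 * (1 * m.real B) := by gcongr
    _ = 2 * m.real B := by ring

/-- A function on `[0, r]` that agrees at any two points at distance at most `δ > 0` takes the same
value at both endpoints. -/
theorem eq_of_forall_abs_sub_le_eq {α : Type*} {c : ℝ → α} {r δ : ℝ} (hr : 0 ≤ r) (hδ : 0 < δ)
    (h : ∀ t ∈ Set.Icc 0 r, ∀ t' ∈ Set.Icc 0 r, |t - t'| ≤ δ → c t = c t') : c r = c 0 := by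
  have key (n : ℕ) : c (min (n * δ) r) = c 0 := by
    induction n with
    | zero => simp [hr]
    | succ n ih =>
      rw [← ih]
      refine h _ ⟨le_min (by positivity) hr, min_le_right _ _⟩ _
        ⟨le_min (by positivity) hr, min_le_right _ _⟩ ?_
      refine (abs_min_sub_min_le_max _ _ _ _).trans ?_
      have : ((n + 1 : ℕ) : ℝ) * δ - n * δ = δ := by push_cast; ring
      rw [this, sub_self, abs_zero, abs_of_pos hδ, max_eq_left hδ.le]
  obtain ⟨n, hn⟩ := exists_nat_ge (r / δ)
  simpa [min_eq_right ((div_le_iff₀ hδ).1 hn)] using key n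

/-- **Step 3 of the uniqueness of orientations: propagation of the sign along a geodesic.**
Under a doubling-type bound `m(B_{2s}) ≤ C · m(B_{s/2})` along a 1-Lipschitz curve
`γ : [0, r] → X`, if `c : [0, r] → {-1, 1}` satisfies
`∫_{B_s(γ(t))} |g - c(t)| dm < ε · m(B_s(γ(t)))` for every `t` and `C · ε ≤ 1`,
then `c(r) = c(0)`. -/
theorem stmt_3 {X : Type*} [MetricSpace X] [MeasurableSpace X] [BorelSpace X]
    (m : Measure X) (r s C ε : ℝ) (hr : 0 < r) (hs : 0 < s) (hsr : s < r)
    (hC : 1 ≤ C) (hε : 0 < ε) (hCε : C * ε ≤ 1)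
    (γ : ℝ → X)
    (hγ : ∀ t ∈ Set.Icc 0 r, ∀ t' ∈ Set.Icc 0 r, dist (γ t) (γ t') ≤ |t - t'|)
    (hpos : ∀ t ∈ Set.Icc 0 r, 0 < m (ball (γ t) (s / 2)))
    (hfin : ∀ t ∈ Set.Icc 0 r, m (ball (γ t) (2 * s)) < ⊤)
    (hdoub : ∀ t ∈ Set.Icc 0 r,
      m (ball (γ t) (2 * s)) ≤ ENNReal.ofReal C * m (ball (γ t) (s / 2)))
    (g : X → ℝ) (hg : ∀ t ∈ Set.Icc 0 r, IntegrableOn g (ball (γ t) (2 * s)) m)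
    (c : ℝ → ℝ) (hc : ∀ t ∈ Set.Icc 0 r, c t = 1 ∨ c t = -1)
    (hest : ∀ t ∈ Set.Icc 0 r,
      ∫ x in ball (γ t) s, |g x - c t| ∂m < ε * (m (ball (γ t) s)).toReal) :
    c r = c 0 := by
  refine eq_of_forall_abs_sub_le_eq hr.le (half_pos hs) fun t ht t' ht' htt' => ?_
  have hd := (hγ t ht t' ht').trans htt'
  have hd' : dist (γ t') (γ t) ≤ s / 2 := by rwa [dist_comm]
  have hlt : |c t - c t'| < 2 :=
    abs_sub_lt_two_of_setIntegral_abs_sub_lt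
      (ball_subset_ball (by linarith)) (ball_subset_ball' (by linarith))
      (ball_subset_ball (by linarith)) (ball_subset_ball' (by linarith))
      (hpos t ht) (hfin t ht) (hdoub t ht) (by linarith) hε.le hCε (hg t ht)
      (hest t ht) (hest t' ht')
  rcases hc t ht with h | h <;> rcases hc t' ht' with h' | h' <;> rw [h, h'] at hlt ⊢ <;>
    norm_num at hlt
end

section
/- Let (X, m) be a measure space, B a measurable set with 0 < m(B) < ∞, L ≥ 1, and 0 < ψ ≤ 1/3. Let g : B → ℝ be integrable with |g(z)| ≤ L for a.e. z ∈ B, and let A ⊆ B be measurable with m(B ∖ A) ≤ ψ·m(B) and | |g(z)| − 1 | ≤ ψ for a.e. z ∈ A. Denote ḡ := (1/m(B)) ∫_B g dm and assume (1/m(B)) ∫_B |g − ḡ| dm ≤ ψ. Then there exists c ∈ {−1, 1} such that (1/m(B)) ∫_B |g − c| dm ≤ (3 + L)ψ. -/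
open MeasureTheory

theorem exists_abs_sub_eq_abs_abs_sub_one (a : ℝ) :
    ∃ c : ℝ, (c = 1 ∨ c = -1) ∧ |a - c| = |(|a| - 1)| := by
  rcases le_total 0 a with ha | ha
  · exact ⟨1, Or.inl rfl, by rw [abs_of_nonneg ha]⟩
  · refine ⟨-1, Or.inr rfl, ?_⟩
    rw [abs_of_nonpos ha, ← abs_neg]
    ring_nf

/-- **Almost-constant-sign lemma (from (eq:1) to (eq:2)).**
If `|g| ≤ L` a.e. on `B`, `|g|` is `ψ`-close to `1` a.e. on `A ⊆ B` with
`m(B \ A) ≤ ψ m(B)`, and the mean oscillation of `g` on `B` is at most `ψ ≤ 1/3`, then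
there is `c ∈ {-1, 1}` with `(1/m(B)) ∫_B |g - c| dm ≤ (3 + L)ψ`. -/
theorem stmt_4 {X : Type*} [MeasurableSpace X] (m : Measure X)
    (B A : Set X) (hB : MeasurableSet B) (hA : MeasurableSet A) (hAB : A ⊆ B)
    (hpos : 0 < m B) (hfin : m B < ⊤)
    (L ψ : ℝ) (hL : 1 ≤ L) (hψ : 0 < ψ) (hψ' : ψ ≤ 1 / 3)
    (g : X → ℝ) (hg : IntegrableOn g B m)
    (hgL : ∀ᵐ z ∂(m.restrict B), |g z| ≤ L)
    (hBA : m (B \ A) ≤ ENNReal.ofReal ψ * m B)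
    (hgA : ∀ᵐ z ∂(m.restrict A), abs (|g z| - 1) ≤ ψ)
    (hosc : (1 / (m B).toReal) *
        ∫ z in B, |g z - (1 / (m B).toReal) * ∫ w in B, g w ∂m| ∂m ≤ ψ) :
    ∃ c : ℝ, (c = 1 ∨ c = -1) ∧
      (1 / (m B).toReal) * ∫ z in B, |g z - c| ∂m ≤ (3 + L) * ψ := by
  have hM : 0 < m.real B := ENNReal.toReal_pos hpos.ne' hfin.ne
  change (1 / m.real B) * ∫ z in B, |g z - (1 / m.real B) * ∫ w in B, g w ∂m| ∂m ≤ ψ at hosc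
  change ∃ c : ℝ, (c = 1 ∨ c = -1) ∧ (1 / m.real B) * ∫ z in B, |g z - c| ∂m ≤ (3 + L) * ψ
  generalize (1 / m.real B) * ∫ w in B, g w ∂m = a at hosc
  obtain ⟨c, hc, hac⟩ := exists_abs_sub_eq_abs_abs_sub_one a
  refine ⟨c, hc, ?_⟩
  have : IsFiniteMeasure (m.restrict B) := ⟨by simpa using hfin⟩
  have hdiff (r : ℝ) : IntegrableOn (fun z => |g z - r|) B m :=
    (hg.sub (integrable_const r)).abs
  have hind : IntegrableOn ((B \ A).indicator fun _ => L) B m :=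
    (integrable_const L).indicator (hB.diff hA)
  have hreal : m.real (B \ A) ≤ ψ * m.real B := by
    have := ENNReal.toReal_mono (ENNReal.mul_ne_top ENNReal.ofReal_ne_top hfin.ne) hBA
    rwa [ENNReal.toReal_mul, ENNReal.toReal_ofReal hψ.le] at this
  have hpt : ∀ᵐ z ∂(m.restrict B),
      |g z - c| ≤ 2 * |g z - a| + ψ + (B \ A).indicator (fun _ => L) z := by
    filter_upwards [hgL, ae_restrict_mem hB,
      ae_restrict_of_ae ((ae_restrict_iff' hA).1 hgA)] with z hzL hzB hzA
    have htri : |g z - c| ≤ 2 * |g z - a| + |(|g z| - 1)| := by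
      have h₁ := abs_sub_le (g z) a c
      have h₂ := abs_sub_le |a| |g z| 1
      have h₃ := abs_abs_sub_abs_le a (g z)
      rw [abs_sub_comm a] at h₃
      linarith
    by_cases hz : z ∈ A
    · have := hzA hz
      simp only [Set.indicator, Set.mem_sdiff, hz, not_true_eq_false, and_false, if_false]
      linarith
    · have : |(|g z| - 1)| ≤ L := abs_le.2 ⟨by linarith [abs_nonneg (g z)], by linarith⟩
      simp only [Set.indicator, Set.mem_sdiff, hz, hzB, not_false_eq_true, and_self, if_true]
      linarith
  have hsum : IntegrableOn (fun z => 2 * |g z - a| + ψ) B m :=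
    ((hdiff a).const_mul 2).add (integrable_const ψ)
  have hint := integral_mono_ae (hdiff c) (hsum.add hind) hpt
  simp only [Pi.add_apply] at hint
  rw [integral_add hsum hind, integral_add ((hdiff a).const_mul 2) (integrable_const ψ),
    integral_const_mul, setIntegral_const, setIntegral_indicator (hB.diff hA),
    Set.inter_eq_self_of_subset_right Set.sdiff_subset, setIntegral_const, smul_eq_mul,
    smul_eq_mul] at hint
  rw [one_div_mul_eq_div, div_le_iff₀ hM] at hosc ⊢
  nlinarith [mul_le_mul_of_nonneg_right hreal (zero_le_one.trans hL)]
end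

section
/- For every natural number n ≥ 2 and every ε > 0 there exist δ > 0 and a Lipschitz function f : [0, π] → [0, 1] such that f ≡ 1 on [0, δ] ∪ [π − δ, π] and ∫₀^π ( f(t)² + f'(t)² ) sin^{n−1}(t) dt < ε. Equivalently, the Sobolev 2-capacity of the two-point set {0, π} with respect to the weighted interval ([0, π], sin^{n−1}t dt) is zero. -/
open MeasureTheory Real

/-- The power `(sin t / a) ^ (-α)`, cut off at `1` where `sin t ≤ a`. -/
noncomputable def truncatedSinPow (α a t : ℝ) : ℝ := (max (sin t) a / a) ^ (-α)

section truncatedSinPow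

variable {α a t : ℝ}

lemma truncatedSinPow_of_sin_le (ha : 0 < a) (h : sin t ≤ a) : truncatedSinPow α a t = 1 := by
  rw [truncatedSinPow, max_eq_right h, div_self ha.ne', one_rpow]

lemma truncatedSinPow_pos (ha : 0 < a) : 0 < truncatedSinPow α a t := by
  have : 0 < max (sin t) a := lt_max_of_lt_right ha
  unfold truncatedSinPow
  positivity

lemma truncatedSinPow_le_one (hα : 0 ≤ α) (ha : 0 < a) : truncatedSinPow α a t ≤ 1 :=
  rpow_le_one_of_one_le_of_nonpos ((one_le_div ha).2 (le_max_right _ _)) (by linarith)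

lemma exists_lipschitzWith_truncatedSinPow (ha : 0 < a) (ha1 : a ≤ 1) :
    ∃ K, LipschitzWith K (truncatedSinPow α a) := by
  have hc : ContDiffOn ℝ 1 (fun x : ℝ ↦ (x / a) ^ (-α)) (Set.Icc a 1) := by
    intro x hx
    have hx0 : 0 < x := ha.trans_le hx.1
    exact ((contDiffAt_id.div_const a).rpow_const_of_ne (by positivity)).contDiffWithinAt
  obtain ⟨K, hK⟩ := hc.exists_lipschitzOnWith (by decide) (convex_Icc _ _) isCompact_Icc
  have hm : LipschitzWith 1 (fun t ↦ max (sin t) a) := lipschitzWith_sin.max_const a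
  refine ⟨K * 1, lipschitzOnWith_univ.1 (hK.comp hm.lipschitzOnWith fun t _ ↦ ?_)⟩
  exact ⟨le_max_right _ _, max_le (sin_le_one t) ha1⟩

lemma deriv_truncatedSinPow_mul_sin (ha : 0 < a) (h : a < sin t) :
    deriv (truncatedSinPow α a) t * sin t = -α * truncatedSinPow α a t * cos t := by
  have hs : 0 < sin t := ha.trans h
  have hev : truncatedSinPow α a =ᶠ[nhds t] fun x ↦ (sin x / a) ^ (-α) := by
    filter_upwards [continuous_sin.continuousAt.eventually (lt_mem_nhds h)] with x hx
    rw [truncatedSinPow, max_eq_left (le_of_lt hx)]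
  have hd : HasDerivAt (fun x ↦ (sin x / a) ^ (-α)) _ t :=
    ((hasDerivAt_sin t).div_const a).rpow_const (Or.inl (by positivity))
  rw [hev.deriv_eq, hd.deriv, hev.eq_of_nhds, rpow_sub_one (by positivity)]
  field_simp

lemma deriv_truncatedSinPow_of_sin_le (hα : 0 ≤ α) (ha : 0 < a) (h : sin t ≤ a) :
    deriv (truncatedSinPow α a) t = 0 := by
  refine IsLocalMax.deriv_eq_zero (Filter.Eventually.of_forall fun x ↦ ?_)
  rw [truncatedSinPow_of_sin_le ha h]
  exact truncatedSinPow_le_one hα ha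

lemma deriv_truncatedSinPow_sq_mul_sin (hα : 0 ≤ α) (ha : 0 < a) :
    deriv (truncatedSinPow α a) t ^ 2 * sin t =
      -α * (truncatedSinPow α a t * deriv (truncatedSinPow α a) t * cos t) := by
  rcases le_or_gt (sin t) a with h | h
  · simp [deriv_truncatedSinPow_of_sin_le hα ha h]
  · have hd := deriv_truncatedSinPow_mul_sin (α := α) ha h
    linear_combination deriv (truncatedSinPow α a) t * hd

lemma truncatedSinPow_sq_mul_sin_le (hα2 : 2 * α ≤ 1) (ha : 0 < a) (ha1 : a ≤ 1) :
    truncatedSinPow α a t ^ 2 * sin t ≤ a ^ (2 * α) := by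
  rcases le_or_gt (sin t) a with h | h
  · rw [truncatedSinPow_of_sin_le ha h, one_pow, one_mul]
    exact h.trans (self_le_rpow_of_le_one ha.le ha1 hα2)
  · have hs : 0 < sin t := ha.trans h
    have hpow : truncatedSinPow α a t ^ 2 * sin t = a ^ (2 * α) * sin t ^ (1 - 2 * α) := by
      rw [truncatedSinPow, max_eq_left h.le, ← rpow_natCast, ← rpow_mul (by positivity),
        div_rpow hs.le ha.le, rpow_sub hs, rpow_one,
        show -α * ((2 : ℕ) : ℝ) = -(2 * α) by push_cast; ring, rpow_neg hs.le, rpow_neg ha.le]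
      field_simp
    rw [hpow]
    exact mul_le_of_le_one_right (by positivity)
      (rpow_le_one hs.le (sin_le_one t) (by linarith))

lemma integral_truncatedSinPow_le (hα : 0 ≤ α) (hα2 : 2 * α ≤ 1) (ha : 0 < a) (ha1 : a ≤ 1)
    {m : ℕ} (hm : m ≠ 0) :
    ∫ t in Set.Ioc (0 : ℝ) π,
      (truncatedSinPow α a t ^ 2 + deriv (truncatedSinPow α a) t ^ 2) * sin t ^ m ≤
        π * a ^ (2 * α) + α := by
  set f := truncatedSinPow α a with hf
  obtain ⟨K, hK⟩ : ∃ K, LipschitzWith K f := exists_lipschitzWith_truncatedSinPow ha ha1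
  have hfac : AbsolutelyContinuousOnInterval f 0 π :=
    hK.lipschitzOnWith.absolutelyContinuousOnInterval
  have hcos : AbsolutelyContinuousOnInterval cos 0 π :=
    lipschitzWith_cos.lipschitzOnWith.absolutelyContinuousOnInterval
  have hF := (hfac.fun_mul hfac).fun_mul hcos
  set F : ℝ → ℝ := fun t ↦ f t * f t * cos t with hFdef
  have hFint : ∫ t in (0 : ℝ)..π, deriv F t = -2 := by
    rw [hF.integral_deriv_eq_sub, hFdef]
    simp only [hf, truncatedSinPow_of_sin_le ha (sin_pi.trans_le ha.le),
      truncatedSinPow_of_sin_le ha (sin_zero.trans_le ha.le), cos_pi, cos_zero]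
    norm_num
  have hbound : ∫ t in (0 : ℝ)..π, (a ^ (2 * α) - α / 2 * deriv F t) = π * a ^ (2 * α) + α := by
    rw [intervalIntegral.integral_sub intervalIntegrable_const
      (hF.intervalIntegrable_deriv.const_mul _), intervalIntegral.integral_const_mul, hFint,
      intervalIntegral.integral_const, smul_eq_mul]
    ring
  rw [← hbound, intervalIntegral.integral_of_le pi_pos.le]
  refine integral_mono_of_nonneg ?_ ?_ ?_
  · filter_upwards [ae_restrict_mem measurableSet_Ioc] with t ht
    have hs : 0 ≤ sin t := sin_nonneg_of_nonneg_of_le_pi ht.1.le ht.2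
    simp only [Pi.zero_apply]
    positivity
  · exact (intervalIntegrable_iff_integrableOn_Ioc_of_le pi_pos.le).1
      (intervalIntegrable_const.sub (hF.intervalIntegrable_deriv.const_mul _))
  · filter_upwards [ae_restrict_mem measurableSet_Ioc,
      ae_restrict_of_ae hK.ae_differentiableAt_real] with t ht hd
    have hs : 0 ≤ sin t := sin_nonneg_of_nonneg_of_le_pi ht.1.le ht.2
    have hderiv : deriv F t = 2 * (f t * deriv f t * cos t) - f t ^ 2 * sin t := by
      have hFt : HasDerivAt F _ t := (hd.hasDerivAt.mul hd.hasDerivAt).mul (hasDerivAt_cos t)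
      rw [hFt.deriv, Pi.mul_apply]
      ring
    calc (f t ^ 2 + deriv f t ^ 2) * sin t ^ m
        ≤ (f t ^ 2 + deriv f t ^ 2) * sin t := by
          gcongr
          exact pow_le_of_le_one hs (sin_le_one t) hm
      _ = (f t ^ 2 * sin t) - α / 2 * (f t ^ 2 * sin t) - α / 2 * deriv F t := by
          rw [hderiv, add_mul, deriv_truncatedSinPow_sq_mul_sin hα ha]
          ring
      _ ≤ a ^ (2 * α) - α / 2 * deriv F t := by
          have hle : f t ^ 2 * sin t ≤ a ^ (2 * α) := truncatedSinPow_sq_mul_sin_le hα2 ha ha1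
          have hnonneg : 0 ≤ α / 2 * (f t ^ 2 * sin t) := by positivity
          linarith

end truncatedSinPow

/-- **Vanishing capacity of `{0, π}` for the weight `sin^{n-1} t dt` (Remark 6.16).**
For every `n ≥ 2` and `ε > 0` there are `δ > 0` and a Lipschitz function
`f : [0, π] → [0, 1]` with `f ≡ 1` on `[0, δ] ∪ [π - δ, π]` and
`∫₀^π (f² + f'²) sin^{n-1} t dt < ε`. -/
theorem stmt_5 :
    ∀ n : ℕ, 2 ≤ n → ∀ ε : ℝ, 0 < ε →
      ∃ δ : ℝ, 0 < δ ∧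
        ∃ f : ℝ → ℝ, (∃ K : NNReal, LipschitzWith K f) ∧
          (∀ t ∈ Set.Icc (0 : ℝ) π, f t ∈ Set.Icc (0 : ℝ) 1) ∧
          (∀ t ∈ Set.Icc (0 : ℝ) δ ∪ Set.Icc (π - δ) π, f t = 1) ∧
          (∫ t in Set.Ioc (0 : ℝ) π, (f t ^ 2 + deriv f t ^ 2) * sin t ^ (n - 1)) < ε := by
  intro n hn ε hε
  obtain ⟨α, hα, hα2, hαε⟩ : ∃ α : ℝ, 0 < α ∧ 2 * α ≤ 1 ∧ α < ε / 2 :=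
    ⟨min (1 / 2) (ε / 4), by positivity, by linarith [min_le_left (1 / 2) (ε / 4)],
      by linarith [min_le_right (1 / 2) (ε / 4)]⟩
  obtain ⟨s, hs, hs1, hsε⟩ : ∃ s : ℝ, 0 < s ∧ s ≤ 1 ∧ s ≤ ε / 8 :=
    ⟨min 1 (ε / 8), by positivity, min_le_left _ _, min_le_right _ _⟩
  obtain ⟨a, ha, ha1, has⟩ : ∃ a : ℝ, 0 < a ∧ a ≤ 1 ∧ a ^ (2 * α) = s :=
    ⟨s ^ (2 * α)⁻¹, by positivity, rpow_le_one hs.le hs1 (by positivity),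
      rpow_inv_rpow hs.le (by positivity)⟩
  refine ⟨a, ha, truncatedSinPow α a, exists_lipschitzWith_truncatedSinPow ha ha1,
    fun t _ ↦ ⟨(truncatedSinPow_pos ha).le, truncatedSinPow_le_one hα.le ha⟩, ?_, ?_⟩
  · rintro t (ht | ht)
    · exact truncatedSinPow_of_sin_le ha ((sin_le ht.1).trans ht.2)
    · refine truncatedSinPow_of_sin_le ha ?_
      rw [← sin_pi_sub]
      exact (sin_le (by linarith [ht.2])).trans (by linarith [ht.1])
  · have hle := integral_truncatedSinPow_le hα.le hα2 ha ha1 (show n - 1 ≠ 0 by omega)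
    rw [has] at hle
    nlinarith [pi_lt_four]
end

section
/- Let n ≥ 3 be a natural number and for each integer k ≥ 1 define f_k : [0, π] → ℝ by f_k(t) = 1 for t ∈ [0, 1/k], f_k(t) = 1 − log(tk)/log 2 for t ∈ (1/k, 2/k], and f_k(t) = 0 for t ∈ (2/k, π]. Then each f_k is Lipschitz with 0 ≤ f_k ≤ 1, f_k ≡ 1 on a neighborhood of 0, and ∫₀^π ( f_k(t)² + f_k'(t)² ) sin^{n−1}(t) dt → 0 as k → ∞. -/
open MeasureTheory Real Filter

/-- The logarithmic cut-off functions of Remark 6.16: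
`f_k(t) = 1` on `[0, 1/k]`, `f_k(t) = 1 - log(tk)/log 2` on `(1/k, 2/k]`,
and `f_k(t) = 0` on `(2/k, π]`. -/
noncomputable def logCutoff (k : ℕ) (t : ℝ) : ℝ :=
  if t ≤ 1 / k then 1
  else if t ≤ 2 / k then 1 - Real.log (t * k) / Real.log 2
  else 0

theorem logCutoff_eq_log_clamp {k : ℕ} (hk : 1 ≤ k) (t : ℝ) :
    logCutoff k t = 1 - log (max 1 (min 2 (t * k))) / log 2 := by
  have hk0 : (0 : ℝ) < k := by exact_mod_cast hk
  have hlog : log 2 ≠ 0 := (log_pos one_lt_two).ne'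
  unfold logCutoff
  simp only [le_div_iff₀ hk0]
  split_ifs with h₁ h₂
  · rw [max_eq_left ((min_le_right _ _).trans h₁)]
    simp
  · rw [min_eq_right h₂, max_eq_right (not_le.mp h₁).le]
  · rw [min_eq_left (not_le.mp h₂).le, max_eq_right one_le_two, div_self hlog, sub_self]

theorem abs_log_sub_log_le {a b : ℝ} (ha : 1 ≤ a) (hb : 1 ≤ b) :
    |log a - log b| ≤ |a - b| := by
  wlog hab : b ≤ a generalizing a b
  · rw [abs_sub_comm, abs_sub_comm a]
    exact this hb ha (not_le.mp hab).le
  have hb0 : 0 < b := by linarith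
  have ha0 : 0 < a := by linarith
  rw [abs_of_nonneg (sub_nonneg.mpr (log_le_log hb0 hab)), abs_of_nonneg (sub_nonneg.mpr hab),
    ← log_div ha0.ne' hb0.ne']
  calc log (a / b) ≤ a / b - 1 := log_le_sub_one_of_pos (div_pos ha0 hb0)
    _ = (a - b) / b := by field_simp
    _ ≤ a - b := div_le_self (sub_nonneg.mpr hab) hb

theorem lipschitzWith_logCutoff {k : ℕ} (hk : 1 ≤ k) :
    LipschitzWith (Real.toNNReal (k / log 2)) (logCutoff k) := by
  have hlog : 0 < log 2 := log_pos one_lt_two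
  refine LipschitzWith.of_dist_le' fun x y => ?_
  have hclamp : |max 1 (min 2 (x * k)) - max 1 (min 2 (y * k))| ≤ |x * k - y * k| := by
    simp only [max_comm (1 : ℝ), min_comm (2 : ℝ)]
    refine (abs_max_sub_max_le_abs _ _ _).trans ?_
    simpa using abs_min_sub_min_le_max (x * k) 2 (y * k) 2
  rw [logCutoff_eq_log_clamp hk, logCutoff_eq_log_clamp hk, dist_eq, dist_eq,
    sub_sub_sub_cancel_left, ← sub_div, abs_div, abs_of_pos hlog, div_mul_eq_mul_div]
  gcongr
  rw [abs_sub_comm]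
  calc _ ≤ _ := abs_log_sub_log_le (le_max_left _ _) (le_max_left _ _)
    _ ≤ |x * k - y * k| := hclamp
    _ = k * |x - y| := by rw [← sub_mul, abs_mul, Nat.abs_cast, mul_comm]

theorem logCutoff_mem_Icc {k : ℕ} (hk : 1 ≤ k) (t : ℝ) :
    logCutoff k t ∈ Set.Icc (0 : ℝ) 1 := by
  have hlog : 0 < log 2 := log_pos one_lt_two
  have h₁ : (1 : ℝ) ≤ max 1 (min 2 (t * k)) := le_max_left _ _
  have h₂ : max 1 (min 2 (t * k)) ≤ 2 := max_le one_le_two (min_le_left _ _)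
  rw [logCutoff_eq_log_clamp hk]
  constructor
  · rw [sub_nonneg, div_le_one hlog]
    exact log_le_log (by linarith) h₂
  · rw [sub_le_self_iff]
    exact div_nonneg (log_nonneg h₁) hlog.le

theorem logCutoff_of_two_div_lt {k : ℕ} {t : ℝ} (ht : 2 / k < t) : logCutoff k t = 0 := by
  have h : (1 : ℝ) / k ≤ 2 / k := by gcongr; norm_num
  rw [logCutoff, if_neg (by linarith), if_neg (by linarith)]

theorem deriv_logCutoff_of_two_div_lt {k : ℕ} {t : ℝ} (ht : 2 / k < t) :
    deriv (logCutoff k) t = 0 := by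
  have h : logCutoff k =ᶠ[nhds t] fun _ => 0 := by
    filter_upwards [lt_mem_nhds ht] with s hs using logCutoff_of_two_div_lt hs
  rw [h.deriv_eq, deriv_const]

theorem norm_logCutoff_energy_density_le {n k : ℕ} (hn : 3 ≤ n) (hk : 1 ≤ k) {t : ℝ}
    (ht : t ∈ Set.Ioc (0 : ℝ) π) :
    ‖(logCutoff k t ^ 2 + deriv (logCutoff k) t ^ 2) * sin t ^ (n - 1)‖ ≤
      (Set.Ioc (0 : ℝ) (2 / k)).indicator (fun _ => 4 + 4 / log 2 ^ 2) t := by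
  have hk1 : (1 : ℝ) ≤ k := by exact_mod_cast hk
  have hlog : 0 < log 2 := log_pos one_lt_two
  by_cases htk : t ≤ 2 / k
  · rw [Set.indicator_of_mem (Set.mem_Ioc.mpr ⟨ht.1, htk⟩)]
    have hsin : 0 ≤ sin t := sin_nonneg_of_nonneg_of_le_pi ht.1.le ht.2
    rw [norm_of_nonneg (by positivity)]
    obtain ⟨hf₀, hf₁⟩ := logCutoff_mem_Icc hk t
    have hderiv : deriv (logCutoff k) t ^ 2 ≤ (k / log 2) ^ 2 := by
      rw [← sq_abs]
      gcongr
      have h := norm_deriv_le_of_lipschitz (x₀ := t) (lipschitzWith_logCutoff hk)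
      rwa [coe_toNNReal _ (by positivity)] at h
    have hsin' : sin t ^ (n - 1) ≤ (2 / k) ^ 2 :=
      calc sin t ^ (n - 1) ≤ sin t ^ 2 :=
            pow_le_pow_of_le_one hsin (sin_le_one t) (by omega)
        _ ≤ (2 / k) ^ 2 := by
            gcongr
            exact (sin_le ht.1.le).trans htk
    calc _ ≤ (1 ^ 2 + (k / log 2) ^ 2) * (2 / k) ^ 2 := by gcongr
      _ = 4 * (1 / k) ^ 2 + 4 / log 2 ^ 2 := by field_simp; ring
      _ ≤ 4 * 1 ^ 2 + 4 / log 2 ^ 2 := by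
          gcongr
          exact (div_le_one (by linarith)).mpr hk1
      _ = _ := by ring
  · rw [Set.indicator_of_notMem fun h => htk h.2, logCutoff_of_two_div_lt (not_le.mp htk),
      deriv_logCutoff_of_two_div_lt (not_le.mp htk)]
    simp

theorem norm_integral_logCutoff_energy_le {n k : ℕ} (hn : 3 ≤ n) (hk : 1 ≤ k) :
    ‖∫ t in Set.Ioc (0 : ℝ) π,
        (logCutoff k t ^ 2 + deriv (logCutoff k) t ^ 2) * sin t ^ (n - 1)‖ ≤
      (4 + 4 / log 2 ^ 2) * (2 / k) := by
  have hint : Integrable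
      ((Set.Ioc (0 : ℝ) (2 / k)).indicator fun _ => 4 + 4 / log 2 ^ 2) volume :=
    (integrable_indicator_iff measurableSet_Ioc).mpr (integrableOn_const (by simp))
  calc _ ≤ ∫ t in Set.Ioc (0 : ℝ) π,
          (Set.Ioc (0 : ℝ) (2 / k)).indicator (fun _ => 4 + 4 / log 2 ^ 2) t :=
        norm_integral_le_of_norm_le hint.integrableOn <|
          (ae_restrict_iff' measurableSet_Ioc).mpr <|
            .of_forall fun _ ht => norm_logCutoff_energy_density_le hn hk ht
    _ ≤ ∫ t, (Set.Ioc (0 : ℝ) (2 / k)).indicator (fun _ => 4 + 4 / log 2 ^ 2) t :=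
        setIntegral_le_integral hint <|
          .of_forall fun _ => Set.indicator_nonneg (fun _ _ => by positivity) _
    _ = _ := by
        rw [integral_indicator_const _ measurableSet_Ioc, volume_real_Ioc_of_le (by positivity),
          sub_zero, smul_eq_mul, mul_comm]

/-- **The explicit capacity witnesses of Remark 6.16.**
For `n ≥ 3`, each `f_k = logCutoff k` (for `k ≥ 1`) is Lipschitz on `[0, π]`,
takes values in `[0, 1]` there, is identically `1` on a neighborhood of `0`, and the
weighted energies `∫₀^π (f_k² + f_k'²) sin^{n-1} t dt` tend to `0` as `k → ∞`. -/
theorem stmt_6 (n : ℕ) (hn : 3 ≤ n) :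
    (∀ k : ℕ, 1 ≤ k →
      (∃ K : NNReal, LipschitzOnWith K (logCutoff k) (Set.Icc 0 π)) ∧
      (∀ t ∈ Set.Icc (0 : ℝ) π, logCutoff k t ∈ Set.Icc (0 : ℝ) 1) ∧
      (∃ δ : ℝ, 0 < δ ∧ ∀ t ∈ Set.Icc (0 : ℝ) δ, logCutoff k t = 1)) ∧
    Tendsto
      (fun k : ℕ =>
        ∫ t in Set.Ioc (0 : ℝ) π,
          (logCutoff k t ^ 2 + deriv (logCutoff k) t ^ 2) * sin t ^ (n - 1))
      atTop (nhds 0) := by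
  refine ⟨fun k hk => ⟨⟨_, (lipschitzWith_logCutoff hk).lipschitzOnWith⟩,
    fun t _ => logCutoff_mem_Icc hk t, 1 / k, ?_, fun t ht => if_pos ht.2⟩, ?_⟩
  · have hk0 : (0 : ℝ) < k := by exact_mod_cast hk
    positivity
  · refine squeeze_zero_norm' (a := fun k : ℕ => (4 + 4 / log 2 ^ 2) * (2 / (k : ℝ))) ?_ ?_
    · filter_upwards [eventually_ge_atTop 1] with k hk
        using norm_integral_logCutoff_energy_le hn hk
    · simpa using (tendsto_const_div_atTop_nhds_zero_nat (2 : ℝ)).const_mul (4 + 4 / log 2 ^ 2)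
end

section
/- There is no Lebesgue-integrable function α : [0, π] → ℝ such that ∫₀^π h'(t) dt = ∫₀^π α(t) h(t) dt for every Lipschitz function h : [0, π] → ℝ, where h' is the a.e.-defined derivative of h. (Indeed ∫₀^π h'(t) dt = h(π) − h(0) for every Lipschitz h, and this boundary functional is not representable by an L¹ density.) Equivalently, the 1-form ω = dt on ([0, π], (1/π)dt) does not belong to D¹(δ₁). -/
open MeasureTheory Real

lemma hasDerivAt_inv_one_add_mul_sq (c t : ℝ) :
    HasDerivAt (fun t : ℝ => (1 + (c * t) ^ 2)⁻¹)
      (-(2 * c * (c * t)) / (1 + (c * t) ^ 2) ^ 2) t := by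
  have h1 : HasDerivAt (fun t : ℝ => 1 + (c * t) ^ 2) (2 * c * (c * t)) t := by
    have h := ((((hasDerivAt_id t).const_mul c).pow 2).const_add 1)
    refine h.congr_deriv ?_
    simp only [id_eq, Nat.cast_ofNat, Nat.add_one_sub_one, pow_one, mul_one]
    ring
  exact h1.inv (by positivity)

lemma deriv_inv_one_add_mul_sq (c : ℝ) :
    deriv (fun t : ℝ => (1 + (c * t) ^ 2)⁻¹) =
      fun t => -(2 * c * (c * t)) / (1 + (c * t) ^ 2) ^ 2 :=
  funext fun t => (hasDerivAt_inv_one_add_mul_sq c t).deriv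

lemma lipschitzWith_inv_one_add_mul_sq (c : ℝ) :
    LipschitzWith ‖c‖₊ (fun t : ℝ => (1 + (c * t) ^ 2)⁻¹) := by
  refine lipschitzWith_of_nnnorm_deriv_le
    (fun t => (hasDerivAt_inv_one_add_mul_sq c t).differentiableAt) fun t => ?_
  rw [deriv_inv_one_add_mul_sq, ← NNReal.coe_le_coe, coe_nnnorm, coe_nnnorm, norm_div, norm_neg,
    norm_mul, norm_mul, Real.norm_eq_abs, Real.norm_eq_abs, Real.norm_eq_abs, Real.norm_eq_abs,
    abs_two, abs_of_pos (by positivity : 0 < (1 + (c * t) ^ 2) ^ 2), div_le_iff₀ (by positivity)]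
  have h : 2 * |c * t| ≤ (1 + (c * t) ^ 2) ^ 2 := by
    rw [← sq_abs (c * t)]
    nlinarith [sq_nonneg (|c * t| - 1), sq_nonneg (|c * t| ^ 2), sq_nonneg |c * t|]
  calc 2 * |c| * |c * t| = |c| * (2 * |c * t|) := by ring
    _ ≤ |c| * (1 + (c * t) ^ 2) ^ 2 := by gcongr

lemma integral_deriv_inv_one_add_mul_sq (c : ℝ) {b : ℝ} (hb : 0 ≤ b) :
    ∫ t in Set.Ioc 0 b, deriv (fun t : ℝ => (1 + (c * t) ^ 2)⁻¹) t =
      (1 + (c * b) ^ 2)⁻¹ - 1 := by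
  rw [← intervalIntegral.integral_of_le hb, intervalIntegral.integral_deriv_eq_sub
    (fun t _ => (hasDerivAt_inv_one_add_mul_sq c t).differentiableAt)]
  · simp
  · rw [deriv_inv_one_add_mul_sq]
    refine Continuous.intervalIntegrable (Continuous.div (by fun_prop) (by fun_prop) fun t => ?_) _ _
    positivity

lemma tendsto_inv_one_add_mul_sq {t : ℝ} (ht : 0 < t) :
    Filter.Tendsto (fun n : ℕ => (1 + ((n : ℝ) * t) ^ 2)⁻¹) Filter.atTop (nhds 0) :=
  tendsto_inv_atTop_zero.comp <| Filter.tendsto_atTop_add_const_left _ _ <|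
    (Filter.tendsto_pow_atTop two_ne_zero).comp <|
      tendsto_natCast_atTop_atTop.atTop_mul_const ht

/-- **Remark 6.17: `dt ∉ D¹(δ₁)` on `([0, π], dt/π)`.**
There is no Lebesgue-integrable `α : [0, π] → ℝ` with
`∫₀^π h'(t) dt = ∫₀^π α(t) h(t) dt` for every Lipschitz `h : [0, π] → ℝ`:
the boundary functional `h ↦ h(π) - h(0)` is not representable by an `L¹` density. -/
theorem stmt_8 :
    ¬ ∃ α : ℝ → ℝ, IntegrableOn α (Set.Icc (0 : ℝ) π) volume ∧
      ∀ h : ℝ → ℝ, (∃ K : NNReal, LipschitzWith K h) →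
        (∫ t in Set.Ioc (0 : ℝ) π, deriv h t) = ∫ t in Set.Ioc (0 : ℝ) π, α t * h t := by
  rintro ⟨α, hα, H⟩
  have hα' : IntegrableOn α (Set.Ioc 0 π) := hα.mono_set Set.Ioc_subset_Icc_self
  have hlim : Filter.Tendsto
      (fun n : ℕ => ∫ t in Set.Ioc (0 : ℝ) π, α t * (1 + ((n : ℝ) * t) ^ 2)⁻¹)
      Filter.atTop (nhds (∫ _ in Set.Ioc (0 : ℝ) π, (0 : ℝ))) := by
    refine tendsto_integral_of_dominated_convergence (fun t => ‖α t‖) (fun n => ?_) hα'.norm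
      (fun n => ?_) ?_
    · exact hα'.aestronglyMeasurable.mul
        (lipschitzWith_inv_one_add_mul_sq n).continuous.aestronglyMeasurable
    · refine Filter.Eventually.of_forall fun t => ?_
      rw [norm_mul, norm_inv, Real.norm_of_nonneg (by positivity : 0 ≤ 1 + ((n : ℝ) * t) ^ 2)]
      exact mul_le_of_le_one_right (norm_nonneg _)
        (inv_le_one_of_one_le₀ (le_add_of_nonneg_right (sq_nonneg _)))
    · refine (ae_restrict_mem measurableSet_Ioc).mono fun t ht => ?_
      simpa using (tendsto_inv_one_add_mul_sq ht.1).const_mul (α t)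
  have heq (n : ℕ) : ∫ t in Set.Ioc (0 : ℝ) π, α t * (1 + ((n : ℝ) * t) ^ 2)⁻¹ =
      (1 + ((n : ℝ) * π) ^ 2)⁻¹ - 1 := by
    rw [← integral_deriv_inv_one_add_mul_sq n pi_pos.le]
    exact (H _ ⟨_, lipschitzWith_inv_one_add_mul_sq n⟩).symm
  simp only [heq, integral_zero] at hlim
  have := tendsto_nhds_unique hlim ((tendsto_inv_one_add_mul_sq pi_pos).sub_const 1)
  norm_num at this
end
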